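/- For every θ ∈ ℝ, the number λ = q^{3/2}e^{iθ} + q e^{−2iθ} + q^{1/2}e^{iθ} is an approximate point eigenvalue of A_w^+ on L²_w: for every δ > 0 there exists f : V → ℂ with 0 < ‖f‖²_w < ∞ and ‖A_w^+ f − λ f‖²_w ≤ δ² ‖f‖²_w. -/

import Mathlib

set_option linter.unusedSectionVars false

noncomputable section

open Filter

/-- The index set `V = {(m,n) ∈ ℕ × ℕ : n ≤ m}` of vertices `v_{m,n}` of the quotient
complex. -/
def Vtx : Type := {p : ℕ × ℕ // p.2 ≤ p.1}

/-- The weight `w(v_{m,n})`. -/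
def wt (q : ℕ) (p : ℕ × ℕ) : ℝ :=
  if p.1 = 0 then 1 / ((q : ℝ)^2 + q + 1)
  else if p.2 = 0 ∨ p.2 = p.1 then 1 / (q : ℝ)^(2 * p.1)
  else ((q : ℝ) + 1) / (q : ℝ)^(2 * p.1)

/-- The weighted adjacency operator `A_w^+`. -/
def Aplus (q : ℕ) (f : ℕ → ℕ → ℂ) : ℕ → ℕ → ℂ := fun m n =>
  if m = 0 then ((q : ℂ)^2 + q + 1) * f 1 0
  else if n = 0 then f (m+1) 0 + ((q : ℂ)^2 + q) * f m 1
  else if n = m then (q : ℂ)^2 * f (m-1) (m-1) + ((q : ℂ) + 1) * f (m+1) m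
  else (q : ℂ)^2 * f (m-1) (n-1) + (q : ℂ) * f m (n+1) + f (m+1) n

/-- The weighted adjacency operator `A_w^-`. -/
def Aminus (q : ℕ) (f : ℕ → ℕ → ℂ) : ℕ → ℕ → ℂ := fun m n =>
  if m = 0 then ((q : ℂ)^2 + q + 1) * f 1 1
  else if n = 0 then (q : ℂ)^2 * f (m-1) 0 + ((q : ℂ) + 1) * f (m+1) 1
  else if n = m then ((q : ℂ)^2 + q) * f m (m-1) + f (m+1) (m+1)
  else (q : ℂ)^2 * f (m-1) n + (q : ℂ) * f m (n-1) + f (m+1) (n+1)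

/-- The squared weighted `L²` norm `‖f‖²_w = Σ_{(m,n) ∈ V} |f(v_{m,n})|² w(v_{m,n})`. -/
def normSqW (q : ℕ) (f : ℕ → ℕ → ℂ) : ℝ :=
  ∑' p : Vtx, ‖f p.1.1 p.1.2‖^2 * wt q p.1

/-- `f ∈ L²_w`: the defining sum of `‖f‖²_w` is finite (summable). -/
def MemL2 (q : ℕ) (f : ℕ → ℕ → ℂ) : Prop :=
  Summable fun p : Vtx => ‖f p.1.1 p.1.2‖^2 * wt q p.1

/-- `f` is a simultaneous `(λ⁺,λ⁻)`-eigenfunction of `A_w^+` and `A_w^-`. -/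
def IsEigen (q : ℕ) (f : ℕ → ℕ → ℂ) (lp lm : ℂ) : Prop :=
  ∀ m n : ℕ, n ≤ m → Aplus q f m n = lp * f m n ∧ Aminus q f m n = lm * f m n

/-- The coefficient `B_{i,j}` (with arguments `(s_i, s_j, s_k)`). -/
def Bc (q : ℕ) (si sj sk : ℂ) : ℂ :=
  ((si - q * sj) * (si - q * sk) * (sj - q * sk)) /
    ((si - sj) * (si - sk) * (sj - sk) * ((q : ℂ) + 1) * ((q : ℂ)^2 + q + 1))

/-- The eigenfunction `f_s(v_{m,n}) = Σ_{(i,j), i ≠ j} B_{i,j} q^m s_i^m s_j^n`. -/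
def fs (q : ℕ) (s1 s2 s3 : ℂ) : ℕ → ℕ → ℂ := fun m n =>
  Bc q s1 s2 s3 * (q : ℂ)^m * s1^m * s2^n + Bc q s1 s3 s2 * (q : ℂ)^m * s1^m * s3^n +
  Bc q s2 s1 s3 * (q : ℂ)^m * s2^m * s1^n + Bc q s2 s3 s1 * (q : ℂ)^m * s2^m * s3^n +
  Bc q s3 s1 s2 * (q : ℂ)^m * s3^m * s1^n + Bc q s3 s2 s1 * (q : ℂ)^m * s3^m * s2^n

/-- The damped function `f_s^ε(v_{m,n}) = (1-ε)^m f_s(v_{m,n})`. -/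
def fse (q : ℕ) (s1 s2 s3 : ℂ) (ε : ℝ) : ℕ → ℕ → ℂ := fun m n =>
  ((1 - ε : ℝ) : ℂ)^m * fs q s1 s2 s3 m n

/-- Eigenfunction in terms of `a = s₂`, `b = s₃`, `s₁ = q b`. -/
def eigF (q : ℕ) (a b : ℂ) (m n : ℕ) : ℂ :=
  (b - q * a) * (q * b - q * a) * (q * b) ^ m * (q * b) ^ n
  - (b - q * a) * (a - q ^ 2 * b) * (q * b) ^ m * a ^ n
  + (a - q * b) * (a - q ^ 2 * b) * (q * a) ^ m * b ^ n

/-- The majorant. -/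
def majG (q : ℕ) (x : ℝ) (d n : ℕ) : ℝ := (q : ℝ) ^ (n + d) * (x ^ d + x ^ n)

lemma eigF_zero (q : ℕ) (a b : ℂ) :
    eigF q a b 0 0 = ((q : ℂ) ^ 2 + q + 1) * (q * b - a) * (b - a) := by
  simp only [eigF]; ring

lemma eigF_origin (q : ℕ) (a b : ℂ) :
    ((q : ℂ) ^ 2 + q + 1) * eigF q a b 1 0 = (q * a + q * b + q ^ 2 * b) * eigF q a b 0 0 := by
  simp only [eigF]; ring

lemma eigF_bottom (q : ℕ) (a b : ℂ) (m : ℕ) :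
    eigF q a b (m + 1) 0 + ((q : ℂ) ^ 2 + q) * eigF q a b m 1
      = (q * a + q * b + q ^ 2 * b) * eigF q a b m 0 := by
  simp only [eigF, pow_succ, pow_zero]; ring

lemma eigF_diag (q : ℕ) (a b : ℂ) (h : (q : ℂ) * a * b ^ 2 = 1) (k : ℕ) :
    (q : ℂ) ^ 2 * eigF q a b k k + ((q : ℂ) + 1) * eigF q a b (k + 2) (k + 1)
      = (q * a + q * b + q ^ 2 * b) * eigF q a b (k + 1) (k + 1) := by
  have : eigF q a b k k = q * a * b ^ 2 * eigF q a b k k := by rw [h, one_mul]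
  rw [this]
  simp only [eigF, mul_pow, pow_succ, pow_zero]; ring

lemma eigF_inner (q : ℕ) (a b : ℂ) (h : (q : ℂ) * a * b ^ 2 = 1) (k j : ℕ) :
    (q : ℂ) ^ 2 * eigF q a b k j + (q : ℂ) * eigF q a b (k + 1) (j + 2) + eigF q a b (k + 2) (j + 1)
      = (q * a + q * b + q ^ 2 * b) * eigF q a b (k + 1) (j + 1) := by
  have : eigF q a b k j = q * a * b ^ 2 * eigF q a b k j := by rw [h, one_mul]
  rw [this]
  simp only [eigF, mul_pow, pow_succ, pow_zero]; ring

lemma majG_nonneg (q : ℕ) (x : ℝ) (hx : 0 < x) (d n : ℕ) : 0 ≤ majG q x d n := by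
  unfold majG; positivity

lemma eigF_bound (q : ℕ) (a b : ℂ) (x t : ℝ) (hx : 0 < x) (hx1 : x < 1) (hxt : x * t = 1)
    (hqt : (q : ℝ) = t ^ 2) (ha : ‖a‖ = 1) (hb : ‖b‖ = x) :
    ∃ C : ℝ, 0 ≤ C ∧ ∀ d n, ‖eigF q a b (n + d) n‖ ≤ C * majG q x d n := by
  have hq : ‖(q : ℂ)‖ = q := by simp
  have ht : (q : ℝ) * x = t := by rw [hqt]; linear_combination t * hxt
  have ht0 : 0 < t := by
    by_contra hc
    nlinarith
  refine ⟨‖(b - q * a) * (q * b - q * a)‖ + ‖(b - q * a) * (a - q ^ 2 * b)‖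
    + ‖(a - q * b) * (a - q ^ 2 * b)‖, by positivity, fun d n => ?_⟩
  have h1 : ‖((q : ℂ) * b) ^ (n + d) * (q * b) ^ n‖ ≤ majG q x d n := by
    rw [norm_mul, norm_pow, norm_pow, norm_mul, hq, hb, ht]
    have : t ^ (n + d) * t ^ n = (q : ℝ) ^ (n + d) * x ^ d := by
      have e : x ^ d * t ^ d = 1 := by rw [← mul_pow, hxt, one_pow]
      rw [hqt, ← pow_mul]
      have : t ^ (2 * (n + d)) = t ^ (n + d) * t ^ n * t ^ d := by ring
      rw [this]; linear_combination (- t ^ (n + d) * t ^ n) * e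
    rw [this, majG]
    have : 0 ≤ (q : ℝ) ^ (n + d) * x ^ n := by positivity
    linarith
  have h2 : ‖((q : ℂ) * b) ^ (n + d) * a ^ n‖ ≤ majG q x d n := by
    rw [norm_mul, norm_pow, norm_pow, norm_mul, hq, hb, ha, one_pow, mul_one, mul_pow, majG]
    have h3 : x ^ (n + d) ≤ x ^ d := pow_le_pow_of_le_one hx.le hx1.le (by omega)
    have h4 : 0 ≤ x ^ n := by positivity
    gcongr
    linarith
  have h3 : ‖((q : ℂ) * a) ^ (n + d) * b ^ n‖ ≤ majG q x d n := by
    rw [norm_mul, norm_pow, norm_pow, norm_mul, hq, hb, ha, mul_one, majG]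
    have h4 : 0 ≤ x ^ d := by positivity
    gcongr
    linarith
  have e : eigF q a b (n + d) n = (b - q * a) * (q * b - q * a) * ((q * b) ^ (n + d) * (q * b) ^ n)
      - (b - q * a) * (a - q ^ 2 * b) * ((q * b) ^ (n + d) * a ^ n)
      + (a - q * b) * (a - q ^ 2 * b) * ((q * a) ^ (n + d) * b ^ n) := by
    simp only [eigF]; ring
  rw [e]
  refine (norm_add_le _ _).trans ?_
  rw [add_mul, add_mul]
  refine add_le_add ((norm_sub_le _ _).trans (add_le_add ?_ ?_)) ?_
  · rw [norm_mul]; gcongr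
  · rw [norm_mul]; gcongr
  · rw [norm_mul]; gcongr

/-- `V ≃ ℕ × ℕ`, via `(d, n) ↦ (n + d, n)`. -/
def vEquiv : ℕ × ℕ ≃ Vtx where
  toFun p := ⟨(p.2 + p.1, p.2), Nat.le_add_right _ _⟩
  invFun v := (v.1.1 - v.1.2, v.1.2)
  left_inv p := by ext <;> simp
  right_inv v := by
    obtain ⟨⟨m, n⟩, h⟩ := v
    apply Subtype.ext
    simp only [Prod.mk.injEq, and_true]
    exact Nat.add_sub_of_le h

lemma wt_nonneg (q : ℕ) (p : ℕ × ℕ) : 0 ≤ wt q p := by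
  unfold wt; split_ifs <;> positivity

lemma wt_le (q : ℕ) (hq : 2 ≤ q) (p : ℕ × ℕ) : wt q p ≤ ((q : ℝ) + 1) / (q : ℝ) ^ (2 * p.1) := by
  have hq' : (2 : ℝ) ≤ q := by exact_mod_cast hq
  unfold wt; split_ifs with h1 h2
  · rw [h1, mul_zero, pow_zero]
    gcongr <;> nlinarith
  · gcongr; linarith
  · exact le_rfl

lemma term_bound (q : ℕ) (hq : 2 ≤ q) (x ρ K y : ℝ) (hx : 0 < x) (hx1 : x < 1) (hρ : 0 < ρ)
    (hρ1 : ρ < 1) (hy : 0 ≤ y) (d n : ℕ)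
    (h : y ≤ K * ρ ^ (n + d) * majG q x d n) :
    y ^ 2 * wt q (n + d, n) ≤ 2 * K ^ 2 * (q + 1) * (x ^ d * ρ ^ n + ρ ^ d * x ^ n) := by
  have hq' : (2 : ℝ) ≤ q := by exact_mod_cast hq
  have hq0 : (0 : ℝ) < q := by linarith
  calc y ^ 2 * wt q (n + d, n)
      ≤ (K * ρ ^ (n + d) * majG q x d n) ^ 2 * (((q : ℝ) + 1) / (q : ℝ) ^ (2 * (n + d))) := by
        gcongr
        · exact wt_nonneg _ _
        · exact wt_le q hq _
    _ = K ^ 2 * (q + 1) * ((ρ ^ (n + d)) ^ 2 * (x ^ d + x ^ n) ^ 2) := by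
        unfold majG
        field_simp
        ring
    _ ≤ K ^ 2 * (q + 1) * (2 * (x ^ d * ρ ^ n + ρ ^ d * x ^ n)) := by
        refine mul_le_mul_of_nonneg_left ?_ (by positivity)
        have a1 : ρ ^ n ≤ 1 := pow_le_one₀ hρ.le hρ1.le
        have a2 : ρ ^ d ≤ 1 := pow_le_one₀ hρ.le hρ1.le
        have a3 : x ^ n ≤ 1 := pow_le_one₀ hx.le hx1.le
        have a4 : x ^ d ≤ 1 := pow_le_one₀ hx.le hx1.le
        have b1 : 0 < ρ ^ n := by positivity
        have b2 : 0 < ρ ^ d := by positivity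
        have b3 : 0 < x ^ n := by positivity
        have b4 : 0 < x ^ d := by positivity
        rw [pow_add]
        have c1 : (ρ ^ n * ρ ^ d) ^ 2 ≤ ρ ^ n := by
          calc (ρ ^ n * ρ ^ d) ^ 2 = ρ ^ n * (ρ ^ n * (ρ ^ d * ρ ^ d)) := by ring
            _ ≤ ρ ^ n * (1 * (1 * 1)) := by gcongr
            _ = ρ ^ n := by ring
        have c2 : (ρ ^ n * ρ ^ d) ^ 2 ≤ ρ ^ d := by
          calc (ρ ^ n * ρ ^ d) ^ 2 = ρ ^ d * (ρ ^ d * (ρ ^ n * ρ ^ n)) := by ring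
            _ ≤ ρ ^ d * (1 * (1 * 1)) := by gcongr
            _ = ρ ^ d := by ring
        have c3 : (x ^ d + x ^ n) ^ 2 ≤ 2 * (x ^ d + x ^ n) := by nlinarith
        calc (ρ ^ n * ρ ^ d) ^ 2 * (x ^ d + x ^ n) ^ 2
            ≤ (ρ ^ n * ρ ^ d) ^ 2 * (2 * (x ^ d + x ^ n)) := by gcongr
          _ = 2 * ((ρ ^ n * ρ ^ d) ^ 2 * x ^ d + (ρ ^ n * ρ ^ d) ^ 2 * x ^ n) := by ring
          _ ≤ 2 * (ρ ^ n * x ^ d + ρ ^ d * x ^ n) := by gcongr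
          _ = _ := by ring
    _ = _ := by ring

lemma hasSum_geo2 (x y : ℝ) (hx : 0 < x) (hx1 : x < 1) (hy : 0 < y) (hy1 : y < 1) :
    HasSum (fun p : ℕ × ℕ => x ^ p.1 * y ^ p.2) ((1 - x)⁻¹ * (1 - y)⁻¹) := by
  have h1 := hasSum_geometric_of_lt_one hx.le hx1
  have h2 := hasSum_geometric_of_lt_one hy.le hy1
  exact h1.mul h2 (h1.summable.mul_of_nonneg h2.summable
    (fun _ => by simp only [Pi.zero_apply]; positivity)
    (fun _ => by simp only [Pi.zero_apply]; positivity))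

lemma sum_bound (q : ℕ) (hq : 2 ≤ q) (x ρ K : ℝ) (hx : 0 < x) (hx1 : x < 1) (hρ : 0 < ρ)
    (hρ1 : ρ < 1) (g : ℕ → ℕ → ℂ)
    (h : ∀ d n, ‖g (n + d) n‖ ≤ K * ρ ^ (n + d) * majG q x d n) :
    MemL2 q g ∧ normSqW q g ≤ K ^ 2 * (4 * (q + 1) * (1 - x)⁻¹) * (1 - ρ)⁻¹ := by
  have hS := ((hasSum_geo2 x ρ hx hx1 hρ hρ1).add (hasSum_geo2 ρ x hρ hρ1 hx hx1)).mul_left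
    (2 * K ^ 2 * ((q : ℝ) + 1))
  have hb : ∀ p : ℕ × ℕ, ‖g (vEquiv p).1.1 (vEquiv p).1.2‖ ^ 2 * wt q (vEquiv p).1
      ≤ 2 * K ^ 2 * ((q : ℝ) + 1) * (x ^ p.1 * ρ ^ p.2 + ρ ^ p.1 * x ^ p.2) := fun p =>
    term_bound q hq x ρ K _ hx hx1 hρ hρ1 (norm_nonneg _) p.1 p.2 (h p.1 p.2)
  have hs : Summable (fun p : ℕ × ℕ =>
      ‖g (vEquiv p).1.1 (vEquiv p).1.2‖ ^ 2 * wt q (vEquiv p).1) :=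
    Summable.of_nonneg_of_le (fun p => mul_nonneg (by positivity) (wt_nonneg _ _)) hb hS.summable
  refine ⟨?_, ?_⟩
  · exact (Equiv.summable_iff vEquiv
      (f := fun p : Vtx => ‖g p.1.1 p.1.2‖ ^ 2 * wt q p.1)).1 hs
  · unfold normSqW
    rw [← Equiv.tsum_eq vEquiv (fun p : Vtx => ‖g p.1.1 p.1.2‖ ^ 2 * wt q p.1)]
    refine (hs.tsum_le_tsum hb hS.summable).trans (le_of_eq ?_)
    rw [hS.tsum_eq]; ring

lemma majG_up (q : ℕ) (x : ℝ) (hx : 0 < x) (hx1 : x < 1) (d n : ℕ) :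
    majG q x (d + 1) n ≤ q * majG q x d n := by
  unfold majG
  have : x ^ (d + 1) ≤ x ^ d := pow_le_pow_of_le_one hx.le hx1.le (by omega)
  calc (q : ℝ) ^ (n + (d + 1)) * (x ^ (d + 1) + x ^ n)
      ≤ (q : ℝ) ^ (n + (d + 1)) * (x ^ d + x ^ n) := by gcongr
    _ = _ := by ring

lemma majG_down (q : ℕ) (x : ℝ) (hx : 0 < x) (hqx : 1 ≤ q * x) (hq1 : (1 : ℝ) ≤ q) (d n : ℕ) :
    majG q x d n ≤ majG q x d (n + 1) := by
  unfold majG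
  have h0 : x ^ d ≤ q * x ^ d := le_mul_of_one_le_left (by positivity) hq1
  have h1 : x ^ n ≤ (q * x) * x ^ n := le_mul_of_one_le_left (by positivity) hqx
  calc (q : ℝ) ^ (n + d) * (x ^ d + x ^ n)
      ≤ (q : ℝ) ^ (n + d) * (q * x ^ d + (q * x) * x ^ n) := by gcongr
    _ = _ := by ring

lemma err_bound (q : ℕ) (hq : 2 ≤ q) (a b : ℂ) (h : (q : ℂ) * a * b ^ 2 = 1) (x C ρ : ℝ)
    (hx : 0 < x) (hx1 : x < 1) (hqx : 1 ≤ q * x) (hC : 0 ≤ C)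
    (hF : ∀ d n, ‖eigF q a b (n + d) n‖ ≤ C * majG q x d n)
    (hρ : 1 / 2 ≤ ρ) (hρ1 : ρ < 1) (d n : ℕ) :
    ‖Aplus q (fun m n => (ρ : ℂ) ^ m * eigF q a b m n) (n + d) n
      - (q * a + q * b + q ^ 2 * b) * ((ρ : ℂ) ^ (n + d) * eigF q a b (n + d) n)‖
      ≤ ((1 - ρ) * (C * (2 * q ^ 2 + (q ^ 2 + q + 1) * q))) * ρ ^ (n + d) * majG q x d n := by
  have hq' : (2 : ℝ) ≤ q := by exact_mod_cast hq
  have hρ0 : 0 < ρ := by linarith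
  have hr1 : ‖(ρ : ℂ) - 1‖ = 1 - ρ := by
    rw [← Complex.ofReal_one, ← Complex.ofReal_sub, Complex.norm_real, Real.norm_eq_abs,
      abs_sub_comm, abs_of_pos]; linarith
  have hr : ∀ k, ‖(ρ : ℂ) ^ k‖ = ρ ^ k := fun k => by
    rw [norm_pow, Complex.norm_real, Real.norm_eq_abs, abs_of_pos hρ0]
  have hG := majG_nonneg q x hx d n
  have hup : ‖eigF q a b (n + d + 1) n‖ ≤ C * (q * majG q x d n) :=
    (hF (d + 1) n).trans (by gcongr; exact majG_up q x hx hx1 d n)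
  -- general estimate
  have key : ∀ (c : ℂ) (z : ℂ), ‖c‖ ≤ (q : ℝ) ^ 2 + q + 1 → ‖z‖ ≤ 2 * (C * majG q x d n) * q ^ 2 * ρ ^ (n + d) →
      ‖(ρ : ℂ) ^ (n + d) * (ρ - 1) * (c * eigF q a b (n + d + 1) n) - (ρ - 1) * z‖ ≤
      ((1 - ρ) * (C * (2 * q ^ 2 + (q ^ 2 + q + 1) * q))) * ρ ^ (n + d) * majG q x d n := by
    intro c z hc hz
    have h1r : 0 ≤ 1 - ρ := by linarith
    refine (norm_sub_le _ _).trans ?_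
    rw [norm_mul, norm_mul, norm_mul, norm_mul, hr, hr1]
    calc ρ ^ (n + d) * (1 - ρ) * (‖c‖ * ‖eigF q a b (n + d + 1) n‖) + (1 - ρ) * ‖z‖
        ≤ ρ ^ (n + d) * (1 - ρ) * (((q : ℝ) ^ 2 + q + 1) * (C * (q * majG q x d n)))
          + (1 - ρ) * (2 * (C * majG q x d n) * q ^ 2 * ρ ^ (n + d)) := by gcongr
      _ = _ := by ring
  rcases Nat.eq_zero_or_pos (n + d) with h0 | h0
  · obtain ⟨rfl, rfl⟩ : n = 0 ∧ d = 0 := by omega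
    convert key ((q : ℂ) ^ 2 + q + 1) 0 ?_ ?_ using 2
    · simp only [Aplus, if_true]
      simp
      linear_combination eigF_origin q a b
    · apply le_of_eq
      have : ((q : ℂ) ^ 2 + q + 1) = (((q : ℝ) ^ 2 + q + 1 : ℝ) : ℂ) := by push_cast; rfl
      rw [this, Complex.norm_real, Real.norm_eq_abs, abs_of_pos]; positivity
    · rw [norm_zero]; positivity
  rcases Nat.eq_zero_or_pos n with rfl | hn
  · convert key 1 0 ?_ ?_ using 2
    · have e := eigF_bottom q a b (0 + d)
      simp only [Aplus, if_neg h0.ne', if_true]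
      linear_combination (ρ : ℂ) ^ (0 + d) * e
    · rw [norm_one]; nlinarith
    · rw [norm_zero]; positivity
  obtain ⟨j, rfl⟩ : ∃ j, n = j + 1 := ⟨n - 1, by omega⟩
  have hz : ‖(q : ℂ) ^ 2 * ((ρ : ℂ) ^ (j + d) * eigF q a b (j + d) j)‖ ≤
      2 * (C * majG q x d (j + 1)) * q ^ 2 * ρ ^ (j + 1 + d) := by
    rw [norm_mul, norm_mul, hr, norm_pow, Complex.norm_natCast]
    have e1 : ρ ^ (j + d) ≤ 2 * ρ ^ (j + 1 + d) := by
      have : ρ ^ (j + 1 + d) = ρ * ρ ^ (j + d) := by ring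
      rw [this]
      have : 0 < ρ ^ (j + d) := by positivity
      nlinarith
    have e2 : ‖eigF q a b (j + d) j‖ ≤ C * majG q x d (j + 1) :=
      (hF d j).trans (by gcongr; exact majG_down q x hx hqx (by linarith) d j)
    calc (q : ℝ) ^ 2 * (ρ ^ (j + d) * ‖eigF q a b (j + d) j‖)
        ≤ (q : ℝ) ^ 2 * ((2 * ρ ^ (j + 1 + d)) * (C * majG q x d (j + 1))) := by gcongr
      _ = _ := by ring
  rcases Nat.eq_zero_or_pos d with rfl | hd
  · convert key ((q : ℂ) + 1) _ ?_ hz using 2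
    · have e := eigF_diag q a b h j
      simp only [Aplus, if_neg h0.ne', if_neg hn.ne', add_zero, if_true, Nat.add_sub_cancel]
      linear_combination (ρ : ℂ) ^ (j + 1) * e
    · have : ((q : ℂ) + 1) = (((q : ℝ) + 1 : ℝ) : ℂ) := by push_cast; rfl
      rw [this, Complex.norm_real, Real.norm_eq_abs, abs_of_pos] <;> nlinarith
  · convert key 1 _ ?_ hz using 2
    · have e := eigF_inner q a b h (j + d) j
      have e1 : j + 1 + d = j + d + 1 := by ring
      have e2 : j + 1 ≠ j + d + 1 := by omega
      rw [e1]
      simp only [Aplus, if_neg hn.ne', if_neg e2, if_neg (Nat.succ_ne_zero (j + d)),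
        Nat.add_sub_cancel]
      linear_combination (ρ : ℂ) ^ (j + d + 1) * e
    · rw [norm_one]; nlinarith

/-- Every `λ = q^{3/2}e^{iθ} + q e^{-2iθ} + q^{1/2}e^{iθ}` (θ ∈ ℝ) is an approximate point
eigenvalue of `A_w^+` on `L²_w`. -/
theorem approx_point_spectrum_hypocycloid (q : ℕ) (hq2 : 2 ≤ q) (hq : IsPrimePow q)
    (θ : ℝ) (lam : ℂ)
    (hlam : lam = ((q : ℂ) * (Real.sqrt q : ℂ)) * Complex.exp (θ * Complex.I) +
      (q : ℂ) * Complex.exp (-(2 * θ) * Complex.I) +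
      (Real.sqrt q : ℂ) * Complex.exp (θ * Complex.I)) :
    ∀ δ : ℝ, 0 < δ → ∃ f : ℕ → ℕ → ℂ,
      MemL2 q f ∧ 0 < normSqW q f ∧
      MemL2 q (fun m n => Aplus q f m n - lam * f m n) ∧
      normSqW q (fun m n => Aplus q f m n - lam * f m n) ≤ δ^2 * normSqW q f := by
  intro δ hδ
  have hq' : (2 : ℝ) ≤ q := by exact_mod_cast hq2
  set t : ℝ := Real.sqrt q with ht
  have ht2 : t ^ 2 = q := Real.sq_sqrt (by linarith)
  have ht1 : 1 < t := by
    rw [ht, Real.lt_sqrt (by norm_num)]; linarith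
  have ht0 : 0 < t := by linarith
  have htC : (t : ℂ) ≠ 0 := by exact_mod_cast ht0.ne'
  have hqC : (q : ℂ) = (t : ℂ) ^ 2 := by exact_mod_cast ht2.symm
  obtain ⟨u, hu⟩ : ∃ u, u = Complex.exp (θ * Complex.I) := ⟨_, rfl⟩
  have hun : ‖u‖ = 1 := by rw [hu]; exact Complex.norm_exp_ofReal_mul_I θ
  obtain ⟨a, ha⟩ : ∃ a, a = Complex.exp (-(2 * θ) * Complex.I) := ⟨_, rfl⟩
  have han : ‖a‖ = 1 := by
    rw [ha]
    have := Complex.norm_exp_ofReal_mul_I (-(2 * θ))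
    push_cast at this
    exact this
  have hau : a * u ^ 2 = 1 := by
    rw [ha, hu, ← Complex.exp_nat_mul, ← Complex.exp_add, Complex.exp_eq_one_iff]
    refine ⟨0, ?_⟩
    push_cast; ring
  obtain ⟨b, hb⟩ : ∃ b, b = u / t := ⟨_, rfl⟩
  have hub : u = b * t := by rw [hb]; field_simp
  have hbn : ‖b‖ = t⁻¹ := by
    rw [hb, norm_div, hun, Complex.norm_real, Real.norm_eq_abs, abs_of_pos ht0, one_div]
  have hx0 : 0 < t⁻¹ := by positivity
  have hx1 : t⁻¹ < 1 := inv_lt_one_of_one_lt₀ ht1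
  have hlam' : lam = q * a + q * b + q ^ 2 * b := by
    rw [hlam, ← hu, ← ha, hub, hqC]; ring
  have hab : (q : ℂ) * a * b ^ 2 = 1 := by
    rw [← hau, hub, hqC]; ring
  have hqx : 1 ≤ (q : ℝ) * t⁻¹ := by
    rw [← ht2]; field_simp; linarith
  obtain ⟨C, hC, hF⟩ := eigF_bound q a b t⁻¹ t hx0 hx1 (inv_mul_cancel₀ ht0.ne') ht2.symm han hbn
  have hF0 : eigF q a b 0 0 ≠ 0 := by
    rw [eigF_zero]
    have h1 : ((q : ℂ) ^ 2 + q + 1) ≠ 0 := by exact_mod_cast (by positivity : q ^ 2 + q + 1 ≠ 0)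
    have h2 : (q : ℂ) * b - a ≠ 0 := by
      intro hc
      have := congrArg norm (sub_eq_zero.1 hc)
      rw [norm_mul, Complex.norm_natCast, hbn, han, ← ht2] at this
      field_simp at this
      linarith
    have h3 : b - a ≠ 0 := by
      intro hc
      have := congrArg norm (sub_eq_zero.1 hc)
      rw [hbn, han] at this
      linarith
    exact mul_ne_zero (mul_ne_zero h1 h2) h3
  obtain ⟨N0, hN0⟩ : ∃ N0, N0 = ‖eigF q a b 0 0‖ ^ 2 * wt q (0, 0) := ⟨_, rfl⟩
  have hN0p : 0 < N0 := by
    rw [hN0]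
    have : 0 < wt q (0, 0) := by simp only [wt, if_true]; positivity
    have := norm_pos_iff.2 hF0
    positivity
  obtain ⟨K, hK⟩ : ∃ K, K = C * (2 * (q : ℝ) ^ 2 + (q ^ 2 + q + 1) * q) := ⟨_, rfl⟩
  obtain ⟨M, hM⟩ : ∃ M, M = 4 * ((q : ℝ) + 1) * (1 - t⁻¹)⁻¹ := ⟨_, rfl⟩
  have hM0 : 0 ≤ M := by
    rw [hM]
    have : 0 < 1 - t⁻¹ := by linarith
    positivity
  obtain ⟨ε, hε⟩ : ∃ ε, ε = min (1 / 2) (δ ^ 2 * N0 / (K ^ 2 * M + 1)) := ⟨_, rfl⟩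
  have hε0 : 0 < ε := by rw [hε]; apply lt_min <;> positivity
  have hε2 : ε ≤ 1 / 2 := by rw [hε]; exact min_le_left _ _
  have hε3 : ε * (K ^ 2 * M + 1) ≤ δ ^ 2 * N0 := by
    rw [← le_div_iff₀ (by positivity), hε]; exact min_le_right _ _
  have hr1 : 1 - ε < 1 := by linarith
  have hr0 : 0 < 1 - ε := by linarith
  have hf := sum_bound q hq2 t⁻¹ (1 - ε) C hx0 hx1 hr0 hr1
    (fun m n => ((1 - ε : ℝ) : ℂ) ^ m * eigF q a b m n) (fun d n => by
      rw [norm_mul, norm_pow, Complex.norm_real, Real.norm_eq_abs, abs_of_pos hr0]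
      calc (1 - ε) ^ (n + d) * ‖eigF q a b (n + d) n‖
          ≤ (1 - ε) ^ (n + d) * (C * majG q t⁻¹ d n) := by gcongr; exact hF d n
        _ = _ := by ring)
  have hE := sum_bound q hq2 t⁻¹ (1 - ε) ((1 - (1 - ε)) * K) hx0 hx1 hr0 hr1
    (fun m n => Aplus q (fun m n => ((1 - ε : ℝ) : ℂ) ^ m * eigF q a b m n) m n
      - lam * (((1 - ε : ℝ) : ℂ) ^ m * eigF q a b m n)) (fun d n => by
      rw [hK, hlam']
      exact err_bound q hq2 a b hab t⁻¹ C (1 - ε) hx0 hx1 hqx hC hF (by linarith) hr1 d n)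
  have hlow : N0 ≤ normSqW q (fun m n => ((1 - ε : ℝ) : ℂ) ^ m * eigF q a b m n) := by
    have := hf.1.le_tsum (⟨(0, 0), le_rfl⟩ : Vtx)
      (fun p _ => mul_nonneg (by positivity) (wt_nonneg _ _))
    simpa [hN0, normSqW] using this
  refine ⟨_, hf.1, lt_of_lt_of_le hN0p hlow, hE.1, hE.2.trans ?_⟩
  rw [← hM]
  calc ((1 - (1 - ε)) * K) ^ 2 * M * (1 - (1 - ε))⁻¹ = ε * (K ^ 2 * M) := by
        have : 1 - (1 - ε) = ε := by ring
        rw [this]; field_simp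
    _ ≤ δ ^ 2 * N0 := by nlinarith
    _ ≤ _ := by gcongr
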